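/- Let k ≥ 3, s ∈ {2,3} and 1 ≤ r ≤ s−1 be integers. Then every non boolean facet defining inequality of Q(C_{sk+r}^k) with positive integer coefficients is a positive multiple of the rank constraint ∑_{i∈Z_{sk+r}} x_i ≥ s+1. -/

import Mathlib

/-- `Cseg n k i` is the set `C^i = {i, i+1, …, i+k−1} ⊆ ℤ_n`. -/
def Cseg (n k : ℕ) (i : ZMod n) : Finset (ZMod n) :=
  (Finset.range k).image fun h : ℕ => i + (h : ZMod n)

/-- A cover of the circulant matrix `C_n^k`. -/
def IsCover (n k : ℕ) (x : Finset (ZMod n)) : Prop :=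
  ∀ i : ZMod n, (x ∩ Cseg n k i).Nonempty

/-- A minimal cover of `C_n^k`. -/
def IsMinimalCover (n k : ℕ) (x : Finset (ZMod n)) : Prop :=
  IsCover n k x ∧ ∀ y : Finset (ZMod n), y ⊂ x → ¬ IsCover n k y

/-- The covering number `τ(C_n^k)`. -/
noncomputable def coveringNumber (n k : ℕ) : ℕ :=
  sInf {m : ℕ | ∃ x : Finset (ZMod n), IsCover n k x ∧ x.card = m}

/-- A minimum cover of `C_n^k`. -/
noncomputable def IsMinimumCover (n k : ℕ) (x : Finset (ZMod n)) : Prop :=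
  IsCover n k x ∧ x.card = coveringNumber n k

/-- `xcov n k i` is the cover `x^i = {i + h·k : 0 ≤ h ≤ ⌈n/k⌉ − 1}`. -/
def xcov (n k : ℕ) (i : ZMod n) : Finset (ZMod n) :=
  (Finset.range ((n + k - 1) / k)).image fun h : ℕ => i + ((h * k : ℕ) : ZMod n)

/-- The cyclic closed interval `[a,b]_n` of `ℤ_n`. -/
def cycInterval (n : ℕ) (a b : ZMod n) : Finset (ZMod n) :=
  (Finset.range ((b - a).val + 1)).image fun h : ℕ => a + (h : ZMod n)

/-- The inequality `a·x ≥ α` is valid for `Q(C_n^k)`. -/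
def IsValid (n k : ℕ) (a : ZMod n → ℤ) (α : ℤ) : Prop :=
  ∀ x : Finset (ZMod n), IsCover n k x → α ≤ ∑ i ∈ x, a i

/-- A root of a valid inequality: a cover satisfying it with equality. -/
def IsRoot (n k : ℕ) (a : ZMod n → ℤ) (α : ℤ) (x : Finset (ZMod n)) : Prop :=
  IsCover n k x ∧ ∑ i ∈ x, a i = α

/-- Characteristic vector of a subset of `ℤ_n`. -/
noncomputable def charVec (n : ℕ) (x : Finset (ZMod n)) : ZMod n → ℝ :=
  fun i => if i ∈ x then 1 else 0

/-- `a·x ≥ α` is facet defining for `Q(C_n^k)`: it is valid, and the characteristic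
vectors of its roots affinely span an `(n−1)`-dimensional affine subspace of `ℝ^n`. -/
def IsFacet (n k : ℕ) (a : ZMod n → ℤ) (α : ℤ) : Prop :=
  IsValid n k a α ∧
    Module.finrank ℝ
      (affineSpan ℝ
        {v : ZMod n → ℝ | ∃ x : Finset (ZMod n), IsRoot n k a α x ∧ v = charVec n x}).direction
      = n - 1

/-- `a·x ≥ α` is a positive multiple of one of the boolean inequalities
`x_i ≥ 0`, `−x_i ≥ −1`, `∑_{j ∈ C^i} x_j ≥ 1`. -/
def IsBooleanMultiple (n k : ℕ) (a : ZMod n → ℤ) (α : ℤ) : Prop :=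
  ∃ c : ℤ, 0 < c ∧
    ( (∃ i : ZMod n, (∀ j, a j = if j = i then c else 0) ∧ α = 0)
    ∨ (∃ i : ZMod n, (∀ j, a j = if j = i then -c else 0) ∧ α = -c)
    ∨ (∃ i : ZMod n, (∀ j, a j = if j ∈ Cseg n k i then c else 0) ∧ α = c) )

/-- `a·x ≥ α` is a positive multiple of the rank constraint `∑ x_i ≥ ⌈n/k⌉`. -/
def IsRankMultiple (n k : ℕ) (a : ZMod n → ℤ) (α : ℤ) : Prop :=
  ∃ c : ℤ, 0 < c ∧ (∀ j, a j = c) ∧ α = c * (((n + k - 1) / k : ℕ) : ℤ)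

/-- Hermite's identity. -/
theorem Int.sum_add_ediv_eq {L : ℕ} (hL : 0 < L) (t : ℤ) :
    ∑ c ∈ Finset.range L, (t + c) / (L : ℤ) = t := by
  have hL' : (L : ℤ) ≠ 0 := by omega
  have hstep : ∀ t : ℤ, ∑ c ∈ Finset.range L, (t + 1 + c) / (L : ℤ)
      = ∑ c ∈ Finset.range L, (t + c) / (L : ℤ) + 1 := by
    intro t
    have h1 := Finset.sum_range_sub (fun c : ℕ => (t + c) / (L : ℤ)) L
    rw [Finset.sum_sub_distrib, Int.add_ediv_of_dvd_right (dvd_refl _), Int.ediv_self hL'] at h1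
    have h2 : ∑ c ∈ Finset.range L, (t + 1 + c) / (L : ℤ)
        = ∑ c ∈ Finset.range L, (t + (c + 1 : ℕ)) / (L : ℤ) :=
      Finset.sum_congr rfl fun c _ => by push_cast; congr 1; ring
    simp only [Nat.cast_zero, add_zero] at h1
    linarith
  induction t using Int.induction_on with
  | zero =>
    refine Finset.sum_eq_zero fun c hc => Int.ediv_eq_zero_of_lt (by omega) ?_
    have := Finset.mem_range.1 hc
    omega
  | succ i ih => rw [hstep, ih]
  | pred i ih =>
    have := hstep (-i - 1)
    rw [sub_add_cancel, ih] at this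
    linarith

open Finset in
/-- A sum over `ZMod n` as a sum over representatives. -/
theorem ZMod.sum_eq_sum_range {n : ℕ} [NeZero n] {M : Type*} [AddCommMonoid M] (f : ZMod n → M) :
    ∑ i, f i = ∑ j ∈ range n, f (j : ZMod n) := by
  refine Finset.sum_nbij' (fun i => i.val) (fun j => (j : ZMod n)) ?_ ?_ ?_ ?_ ?_
  · intro i _; simpa using ZMod.val_lt i
  · intro j _; simp
  · intro i _; simp
  · intro j hj; simpa using ZMod.val_cast_of_lt (by simpa using hj)
  · intro i _; simp

/-- `P` is the counting function of a periodic multiset of `ℕ` with `M` points in every period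
of length `n` and at least `N` points in every window of length `k`. -/
structure IsCounting (n k : ℕ) (M N : ℤ) (P : ℕ → ℤ) : Prop where
  mono : ∀ j, P j ≤ P (j + 1)
  periodic : ∀ j, P (j + n) = P j + M
  window : ∀ j, P j + N ≤ P (j + k)

/-- The total weight of the multiset with counting function `P`. -/
def countingWeight (n : ℕ) [NeZero n] (a : ZMod n → ℤ) (P : ℕ → ℤ) : ℤ :=
  ∑ i : ZMod n, a i * (P (i.val + 1) - P i.val)

namespace IsCounting

variable {n k : ℕ} {M N : ℤ} {P : ℕ → ℤ}

theorem monotone (h : IsCounting n k M N P) : Monotone P :=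
  monotone_nat_of_le_succ h.mono

theorem add_mul (h : IsCounting n k M N P) (j q : ℕ) : P (j + n * q) = P j + M * q := by
  induction q with
  | zero => simp
  | succ q ih =>
    rw [Nat.mul_succ, ← add_assoc, h.periodic, ih]; push_cast; ring

theorem sum_window (h : IsCounting n k M N P) (w : ℕ) :
    ∑ j ∈ Finset.range n, (P (j + w) - P j) = w * M := by
  induction w with
  | zero => simp
  | succ w ih =>
    have h1 : ∑ j ∈ Finset.range n, (P (j + 1 + w) - P (j + w)) = P (n + w) - P (0 + w) :=
      Finset.sum_range_sub (fun j => P (j + w)) n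
    have h2 := h.periodic w
    rw [add_comm w n] at h2
    have h3 : ∑ j ∈ Finset.range n, (P (j + (w + 1)) - P j)
        = ∑ j ∈ Finset.range n, (P (j + 1 + w) - P (j + w))
          + ∑ j ∈ Finset.range n, (P (j + w) - P j) := by
      rw [← Finset.sum_add_distrib]
      refine Finset.sum_congr rfl fun j _ => ?_
      rw [show j + (w + 1) = j + 1 + w by ring]; ring
    rw [h3, h1, ih, h2, zero_add]; push_cast; ring

theorem le_total (h : IsCounting n k M N P) : n * N ≤ k * M := by
  rw [← h.sum_window k]
  calc (n : ℤ) * N = ∑ j ∈ Finset.range n, N := by simp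
    _ ≤ _ := Finset.sum_le_sum fun j _ => by linarith [h.window j]

theorem exists_dense_window (h : IsCounting n k M N P) (c : ℤ) (w : ℕ) (hc : n * c < w * M) :
    ∃ b, P b + c + 1 ≤ P (b + w) := by
  by_contra! hcon
  have h1 : ∑ j ∈ Finset.range n, (P (j + w) - P j) ≤ ∑ j ∈ Finset.range n, c :=
    Finset.sum_le_sum fun j _ => by linarith [hcon j]
  rw [h.sum_window w] at h1
  simp at h1
  linarith

theorem add_const (h : IsCounting n k M N P) (c : ℤ) : IsCounting n k M N fun j => P j + c where
  mono j := by linarith [h.mono j]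
  periodic j := by linarith [h.periodic j]
  window j := by linarith [h.window j]

theorem val_cast [NeZero n] (h : IsCounting n k M N P) (j : ℕ) :
    P ((j : ZMod n).val + 1) - P (j : ZMod n).val = P (j + 1) - P j := by
  rw [ZMod.val_natCast]
  have h1 := h.add_mul (j % n) (j / n)
  have h2 := h.add_mul (j % n + 1) (j / n)
  rw [Nat.mod_add_div] at h1
  rw [add_right_comm, Nat.mod_add_div] at h2
  linarith

theorem sum_increments [NeZero n] (h : IsCounting n k M N P) :
    ∑ i : ZMod n, (P (i.val + 1) - P i.val) = M := by
  rw [ZMod.sum_eq_sum_range, Finset.sum_congr rfl fun j _ => h.val_cast j, Finset.sum_range_sub]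
  have := h.periodic 0
  rw [zero_add] at this
  linarith

theorem le_weight [NeZero n] (h : IsCounting n k M 1 P) {a : ZMod n → ℤ} {α : ℤ}
    (hv : IsValid n k a α) (ha : ∀ i, 0 ≤ a i) : α ≤ countingWeight n a P := by
  classical
  set x : Finset (ZMod n) := Finset.univ.filter fun i => P i.val < P (i.val + 1) with hx
  have hcov : IsCover n k x := by
    intro i
    obtain ⟨t, ht, hlt⟩ : ∃ t ∈ Finset.range k, P (i.val + t) < P (i.val + (t + 1)) := by
      by_contra! hcon
      have h1 : ∑ t ∈ Finset.range k, (P (i.val + (t + 1)) - P (i.val + t)) ≤ 0 :=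
        Finset.sum_nonpos fun t ht => by linarith [hcon t ht]
      rw [Finset.sum_range_sub fun t => P (i.val + t)] at h1
      have := h.window i.val
      simp at h1
      linarith
    have he : ((i.val + t : ℕ) : ZMod n) = i + (t : ZMod n) := by simp
    refine ⟨i + (t : ZMod n), Finset.mem_inter.2 ⟨?_, Finset.mem_image.2 ⟨t, ht, rfl⟩⟩⟩
    rw [← he, hx, Finset.mem_filter]
    refine ⟨Finset.mem_univ _, ?_⟩
    have := h.val_cast (i.val + t)
    rw [add_assoc] at this
    linarith
  refine (hv x hcov).trans ?_
  rw [countingWeight]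
  calc ∑ i ∈ x, a i ≤ ∑ i ∈ x, a i * (P (i.val + 1) - P i.val) := by
        refine Finset.sum_le_sum fun i hi => ?_
        rw [hx, Finset.mem_filter] at hi
        exact le_mul_of_one_le_right (ha i) (by linarith [hi.2])
    _ ≤ _ := Finset.sum_le_sum_of_subset_of_nonneg (Finset.subset_univ _) fun i _ _ =>
        mul_nonneg (ha i) (by linarith [h.mono i.val])

/-- If a window of length `k + 1` contains the points with indices `-1, …, c - 1`, then a window
of length `k` whose first point has index divisible by `M` has at least `c` points. -/
theorem lt_of_window (h : IsCounting n k M N P) {b j : ℕ} {q c d : ℤ} (hb : P b < 0)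
    (hbk : c ≤ P (b + k + 1)) (hj : P j = M * q) (hjk : P (j + k) = M * q + d) : c ≤ d := by
  have key : ∀ b j : ℕ, P b < P j → P (b + k + 1) ≤ P (j + k) := by
    intro b j hlt
    have hbj : b < j := by
      by_contra! hcon
      linarith [h.monotone hcon]
    exact h.monotone (by omega)
  rcases _root_.le_total 0 q with hq | hq
  · lift q to ℕ using hq
    have h1 := h.add_mul b q
    have h2 := h.add_mul (b + k + 1) q
    have := key (b + n * q) j (by linarith)
    rw [show b + n * q + k + 1 = b + k + 1 + n * q by ring] at this
    linarith
  · obtain ⟨m, rfl⟩ : ∃ m : ℕ, q = -m := ⟨q.natAbs, by omega⟩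
    have h1 := h.add_mul j m
    have h2 := h.add_mul (j + k) m
    have := key b (j + n * m) (by linarith)
    rw [show j + n * m + k = j + k + n * m by ring] at this
    linarith

/-- A cover with three points in a window of length `k + 1` is not of minimum weight. -/
theorem lt_weight [NeZero n] (h : IsCounting n k M 1 P) {a : ZMod n → ℤ} {α : ℤ}
    (hv : IsValid n k a α) (ha : ∀ i, 1 ≤ a i) (hM : 2 ≤ M) {b : ℕ}
    (hb : P b + 3 ≤ P (b + k + 1)) : α < countingWeight n a P := by
  set Q : ℕ → ℤ := fun j => P j + (-1 - P b) with hQ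
  have hQc : IsCounting n k M 1 Q := h.add_const _
  set H : ℤ → ℤ := fun t => (t + (M - 1)) / M with hH
  have hH1 : ∀ t, H (t + M) = H t + 1 := fun t => by
    simp only [hH]
    rw [show t + M + (M - 1) = t + (M - 1) + M * 1 by ring, Int.add_mul_ediv_left _ _ (by omega)]
  have hHm : Monotone H := fun s t hst => Int.ediv_le_ediv (by omega) (by linarith)
  have hH2 : ∀ s t, s ≤ t → H t - H s ≤ t - s := by
    intro s t hst
    simp only [hH]
    have h1 := Int.ediv_mul_le (t + (M - 1)) (show M ≠ 0 by omega)
    have h2 := Int.lt_ediv_add_one_mul_self (s + (M - 1)) (show 0 < M by omega)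
    by_contra! hcon
    nlinarith
  have hH3 : ∀ s t, s + 1 ≤ t → (∀ q, s = M * q → t ≠ M * q + 1) → H t - H s + 1 ≤ t - s := by
    intro s t hst hne
    have hstep : ∀ q, H q + 1 ≤ H (q + 1) → ∃ p, q = M * p := by
      intro q hq
      simp only [hH] at hq
      have h1 := Int.ediv_mul_le (q + 1 + (M - 1)) (show M ≠ 0 by omega)
      have h2 := Int.lt_ediv_add_one_mul_self (q + (M - 1)) (show 0 < M by omega)
      refine ⟨(q + (M - 1)) / M, ?_⟩
      nlinarith
    by_contra! hcon
    have e1 := hH2 (s + 1) t hst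
    have e2 := hH2 s (s + 1) (by omega)
    obtain ⟨p, hp⟩ := hstep s (by omega)
    rcases eq_or_lt_of_le hst with he | hlt
    · exact hne p hp (by rw [← he, hp])
    · have e3 := hH2 (s + 1 + 1) t hlt
      have e4 := hH2 (s + 1) (s + 1 + 1) (by omega)
      obtain ⟨p', hp'⟩ := hstep (s + 1) (by omega)
      have : M * (p' - p) = 1 := by rw [mul_sub]; omega
      have := Int.eq_one_or_neg_one_of_mul_eq_one this
      omega
  have hHQ : IsCounting n k 1 0 fun j => H (Q j) :=
    { mono := fun j => hHm (hQc.mono j)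
      periodic := fun j => by rw [hQc.periodic, hH1]
      window := fun j => by
        have := hHm (hQc.monotone (Nat.le_add_right j k))
        linarith }
  have hR : IsCounting n k (M - 1) 1 fun j => Q j - H (Q j) :=
    { mono := fun j => by have := hH2 _ _ (hQc.mono j); linarith
      periodic := fun j => by rw [hQc.periodic, hH1]; ring
      window := fun j => by
        have := hH3 (Q j) (Q (j + k)) (hQc.window j) fun q h1 h2 => by
          have : (2 : ℤ) ≤ 1 := hQc.lt_of_window (b := b) (by simp [hQ])
            (by simp only [hQ]; linarith) h1 h2
          omega
        linarith }
  have h1 := hR.le_weight hv fun i => by linarith [ha i]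
  have h2 : 1 ≤ countingWeight n a fun j => H (Q j) := by
    rw [← hHQ.sum_increments, countingWeight]
    refine Finset.sum_le_sum fun i _ => ?_
    exact le_mul_of_one_le_left (by linarith [hHQ.mono i.val]) (ha i)
  have h3 : countingWeight n a P = (countingWeight n a fun j => Q j - H (Q j))
      + countingWeight n a fun j => H (Q j) := by
    simp only [countingWeight, ← Finset.sum_add_distrib, hQ]
    exact Finset.sum_congr rfl fun i _ => by ring
  linarith

/-- A double cover with nine points, four of them in a window of length `k + 1`, splits into
two covers. -/
theorem two_mul_le_weight [NeZero n] (h : IsCounting n k 9 2 P) {a : ZMod n → ℤ} {α : ℤ}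
    (hv : IsValid n k a α) (ha : ∀ i, 0 ≤ a i) {b : ℕ} (hb : P b + 4 ≤ P (b + k + 1)) :
    2 * α ≤ countingWeight n a P := by
  set Q : ℕ → ℤ := fun j => P j + (-1 - P b) with hQ
  have hQc : IsCounting n k 9 2 Q := h.add_const _
  set G : ℤ → ℤ := fun t => (t + 6) / 9 + (t + 4) / 9 + (t + 2) / 9 + t / 9 with hG
  set K : ℤ → ℤ := fun t => (t + 8) / 9 + (t + 7) / 9 + (t + 5) / 9 + (t + 3) / 9 + (t + 1) / 9
    with hK
  have hKG : ∀ t, K t + G t = t := fun t => by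
    have := Int.sum_add_ediv_eq (L := 9) (by norm_num) t
    simp only [Finset.sum_range_succ, Finset.sum_range_zero] at this
    push_cast at this
    simp only [hK, hG]
    rw [add_zero] at this
    linarith
  have hdiv : ∀ c s t : ℤ, s ≤ t → (s + c) / 9 ≤ (t + c) / 9 := fun c s t hst =>
    Int.ediv_le_ediv (by norm_num) (by linarith)
  have hGm : Monotone G := fun s t hst =>
    add_le_add (add_le_add (add_le_add (hdiv _ _ _ hst) (hdiv _ _ _ hst)) (hdiv _ _ _ hst))
      (Int.ediv_le_ediv (by norm_num) hst)
  have hKm : Monotone K := fun s t hst =>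
    add_le_add (add_le_add (add_le_add (add_le_add (hdiv _ _ _ hst) (hdiv _ _ _ hst))
      (hdiv _ _ _ hst)) (hdiv _ _ _ hst)) (hdiv _ _ _ hst)
  have hG9 : ∀ t, G (t + 9) = G t + 4 := fun t => by simp only [hG]; omega
  have hK9 : ∀ t, K (t + 9) = K t + 5 := fun t => by linarith [hKG t, hKG (t + 9), hG9 t]
  have hG1 : ∀ s t, s + 2 ≤ t → (s = 9 * (s / 9) → t ≠ 9 * (s / 9) + 2) → G s + 1 ≤ G t := by
    intro s t hst hne
    have h2 := hGm hst
    by_cases hs : s = 9 * (s / 9)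
    · have hne := hne hs
      have h3 := hGm (show s + 3 ≤ t by omega)
      have h4 : G s + 1 ≤ G (s + 3) := by simp only [hG]; omega
      exact h4.trans h3
    · have h4 : G s + 1 ≤ G (s + 2) := by simp only [hG]; omega
      exact h4.trans h2
  have h4 : IsCounting n k 4 1 fun j => G (Q j) :=
    { mono := fun j => hGm (hQc.mono j)
      periodic := fun j => by rw [hQc.periodic, hG9]
      window := fun j => by
        refine hG1 _ _ (hQc.window j) fun h1 h2 => ?_
        have : (3 : ℤ) ≤ 2 := hQc.lt_of_window (b := b) (by simp [hQ])
            (by simp only [hQ]; linarith) h1 h2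
        omega }
  have h5 : IsCounting n k 5 1 fun j => K (Q j) :=
    { mono := fun j => hKm (hQc.mono j)
      periodic := fun j => by rw [hQc.periodic, hK9]
      window := fun j => by
        have h1 : K (Q j) + 1 ≤ K (Q j + 2) := by simp only [hK]; omega
        exact h1.trans (hKm (hQc.window j)) }
  have h6 : countingWeight n a P = (countingWeight n a fun j => K (Q j))
      + countingWeight n a fun j => G (Q j) := by
    simp only [countingWeight, ← Finset.sum_add_distrib]
    refine Finset.sum_congr rfl fun i _ => ?_
    have h1 := hKG (Q i.val)
    have h2 := hKG (Q (i.val + 1))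
    rw [← mul_add]
    congr 1
    have h3 : Q (i.val + 1) - Q i.val = P (i.val + 1) - P i.val := by simp only [hQ]; ring
    linarith
  linarith [h4.le_weight hv ha, h5.le_weight hv ha]

end IsCounting

/-- An equitable splitting of a multiple cover with average size `9 / 2`. -/
theorem IsCounting.mul_le_weight {n k L : ℕ} [NeZero n] (hL : 0 < L) (hn : n < 3 * k + 3)
    {P : ℕ → ℤ} (h : IsCounting n k (9 * L) (2 * L) P) {a : ZMod n → ℤ} {α : ℤ}
    (hv : IsValid n k a α) (ha : ∀ i, 0 ≤ a i) : L * (2 * α) ≤ countingWeight n a P := by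
  have hL' : (L : ℤ) ≠ 0 := by omega
  have hc : ∀ c : ℕ, IsCounting n k 9 2 fun j => (P j + c) / (L : ℤ) := fun c =>
    { mono := fun j => Int.ediv_le_ediv (by omega) (by linarith [h.mono j])
      periodic := fun j => by
        rw [h.periodic, add_right_comm, Int.add_mul_ediv_right _ _ hL']
      window := fun j => by
        rw [← Int.add_mul_ediv_right _ _ hL']
        exact Int.ediv_le_ediv (by omega) (by linarith [h.window j]) }
  have hw : countingWeight n a P
      = ∑ c ∈ Finset.range L, countingWeight n a fun j => (P j + c) / (L : ℤ) := by
    simp only [countingWeight]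
    rw [Finset.sum_comm]
    refine Finset.sum_congr rfl fun i _ => ?_
    rw [← Finset.mul_sum, Finset.sum_sub_distrib, Int.sum_add_ediv_eq hL, Int.sum_add_ediv_eq hL]
  rw [hw]
  calc (L : ℤ) * (2 * α) = ∑ c ∈ Finset.range L, 2 * α := by simp
    _ ≤ _ := Finset.sum_le_sum fun c _ => by
      obtain ⟨b, hb⟩ := (hc c).exists_dense_window 3 (k + 1) (by push_cast; omega)
      exact (hc c).two_mul_le_weight hv ha (b := b) (by rw [add_assoc b k 1]; linarith)

/-- The counting function of a multiset of `ZMod n` with multiplicities `Z`. -/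
def countingOf {n : ℕ} (Z : ZMod n → ℤ) (j : ℕ) : ℤ :=
  ∑ i ∈ Finset.range j, Z (i : ZMod n)

theorem countingOf_add {n : ℕ} (Z : ZMod n → ℤ) (j w : ℕ) :
    countingOf Z (j + w) = countingOf Z j + ∑ i ∈ Finset.range w, Z ((j : ZMod n) + i) := by
  simp [countingOf, Finset.sum_range_add]

theorem isCounting_countingOf {n k : ℕ} [NeZero n] {Z : ZMod n → ℤ} {N : ℤ} (hZ : ∀ i, 0 ≤ Z i)
    (hN : ∀ i : ZMod n, N ≤ ∑ h ∈ Finset.range k, Z (i + h)) :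
    IsCounting n k (∑ i, Z i) N (countingOf Z) where
  mono j := by rw [countingOf_add]; simpa using hZ _
  periodic j := by
    rw [countingOf_add, ← ZMod.sum_eq_sum_range fun i => Z ((j : ZMod n) + i)]
    congr 1
    exact Equiv.sum_comp (Equiv.addLeft (j : ZMod n)) Z
  window j := by rw [countingOf_add]; linarith [hN j]

theorem countingWeight_countingOf {n : ℕ} [NeZero n] (a Z : ZMod n → ℤ) :
    countingWeight n a (countingOf Z) = ∑ i, a i * Z i := by
  refine Finset.sum_congr rfl fun i _ => ?_
  rw [countingOf_add]; simp

/-- The indicator function of a set, with integer values. -/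
def indicatorInt {n : ℕ} (x : Finset (ZMod n)) (i : ZMod n) : ℤ := if i ∈ x then 1 else 0

theorem indicatorInt_nonneg {n : ℕ} (x : Finset (ZMod n)) (i : ZMod n) :
    0 ≤ indicatorInt x i := by
  unfold indicatorInt; split_ifs <;> norm_num

theorem sum_mul_indicatorInt {n : ℕ} [NeZero n] (a : ZMod n → ℤ) (x : Finset (ZMod n)) :
    ∑ i, a i * indicatorInt x i = ∑ i ∈ x, a i := by
  simp [indicatorInt]

theorem sum_indicatorInt {n : ℕ} [NeZero n] (x : Finset (ZMod n)) :
    ∑ i, indicatorInt x i = x.card := by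
  simp [indicatorInt]

theorem card_inter_Cseg_le {n k : ℕ} (x : Finset (ZMod n)) (i : ZMod n) :
    ((x ∩ Cseg n k i).card : ℤ) ≤ ∑ h ∈ Finset.range k, indicatorInt x (i + h) := by
  have hsub : x ∩ Cseg n k i ⊆
      ((Finset.range k).filter fun h : ℕ => i + (h : ZMod n) ∈ x).image
        fun h : ℕ => i + (h : ZMod n) := by
    intro j hj
    obtain ⟨hjx, hj⟩ := Finset.mem_inter.1 hj
    obtain ⟨h, hh, rfl⟩ := Finset.mem_image.1 hj
    exact Finset.mem_image.2 ⟨h, Finset.mem_filter.2 ⟨hh, hjx⟩, rfl⟩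
  have h1 := (Finset.card_le_card hsub).trans Finset.card_image_le
  rw [Finset.card_filter] at h1
  unfold indicatorInt
  exact_mod_cast h1

theorem IsCover.isCounting {n k : ℕ} [NeZero n] {x : Finset (ZMod n)} (hx : IsCover n k x) :
    IsCounting n k x.card 1 (countingOf (indicatorInt x)) := by
  rw [← sum_indicatorInt]
  refine isCounting_countingOf (indicatorInt_nonneg x) fun i => ?_
  have h1 := card_inter_Cseg_le (k := k) x i
  have h2 := (hx i).card_pos
  omega

theorem IsRoot.card_lt {n k : ℕ} [NeZero n] {a : ZMod n → ℤ} {α : ℤ} {x : Finset (ZMod n)}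
    (hv : IsValid n k a α) (ha : ∀ i, 1 ≤ a i) (hx : IsRoot n k a α x) (m : ℕ) (hm : 2 ≤ m)
    (hn : 2 * n < m * (k + 1)) : x.card < m := by
  by_contra! hcon
  have hc := hx.1.isCounting
  have h1 : (n : ℤ) * 2 < (k + 1 : ℕ) * x.card := by
    have : m * (k + 1) ≤ x.card * (k + 1) := Nat.mul_le_mul_right _ hcon
    push_cast
    zify at this hn
    linarith
  obtain ⟨b, hb⟩ := hc.exists_dense_window 2 (k + 1) h1
  have := hc.lt_weight hv ha (by omega) (b := b) (by rw [add_assoc b k 1]; linarith)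
  rw [countingWeight_countingOf, sum_mul_indicatorInt, hx.2] at this
  exact lt_irrefl _ this

/-- An equation satisfied by all roots of a facet is proportional to the facet. -/
theorem IsFacet.proportional {n k : ℕ} [NeZero n] {a : ZMod n → ℤ} {α : ℤ}
    (hf : IsFacet n k a α) {b : ZMod n → ℤ} {β : ℤ}
    (hb : ∀ x, IsRoot n k a α x → ∑ i ∈ x, b i = β) (i j : ZMod n) :
    a i * b j = a j * b i := by
  classical
  by_cases hb0 : b = 0
  · simp [hb0]
  set S : Set (ZMod n → ℝ) := {v | ∃ x, IsRoot n k a α x ∧ v = charVec n x} with hS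
  let F : (ZMod n → ℤ) → (ZMod n → ℝ) →ₗ[ℝ] ℝ := fun c =>
    ∑ i, (c i : ℝ) • LinearMap.proj i
  have hF : ∀ c v, F c v = ∑ i, (c i : ℝ) * v i := fun c v => by simp [F]
  have hle : ∀ (c : ZMod n → ℤ) (γ : ℤ), (∀ x, IsRoot n k a α x → ∑ i ∈ x, c i = γ) →
      (affineSpan ℝ S).direction ≤ LinearMap.ker (F c) := by
    intro c γ hc
    rw [direction_affineSpan, vectorSpan_def, Submodule.span_le]
    rintro _ ⟨_, ⟨x, hx, rfl⟩, _, ⟨y, hy, rfl⟩, rfl⟩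
    have hval : ∀ x, IsRoot n k a α x → F c (charVec n x) = γ := by
      intro x hx
      rw [hF, ← hc x hx]
      simp [charVec]
    simp [hval x hx, hval y hy]
  have hker : Module.finrank ℝ (LinearMap.ker (F b)) = n - 1 := by
    obtain ⟨l, hl⟩ := Function.ne_iff.1 hb0
    have hsurj : Function.Surjective (F b) := by
      refine LinearMap.surjective fun h0 => hl ?_
      have := hF b (Pi.single l 1)
      rw [h0] at this
      simpa [Pi.single_apply] using this.symm
    have h1 := LinearMap.finrank_range_add_finrank_ker (F b)
    rw [LinearMap.range_eq_top.2 hsurj] at h1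
    simp [ZMod.card] at h1
    omega
  have heq := Submodule.eq_of_le_of_finrank_eq (hle b β hb) (by rw [hker]; exact hf.2)
  have hab : LinearMap.ker (F b) ≤ LinearMap.ker (F a) := heq ▸ hle a α fun x hx => hx.2
  have hmem : (b j : ℝ) • (Pi.single i 1 : ZMod n → ℝ) - (b i : ℝ) • Pi.single j 1
      ∈ LinearMap.ker (F b) := by
    rw [LinearMap.mem_ker, map_sub, map_smul, map_smul, hF, hF]
    simp [Pi.single_apply, mul_comm]
  have := hab hmem
  rw [LinearMap.mem_ker, map_sub, map_smul, map_smul, hF, hF] at this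
  simp [Pi.single_apply] at this
  have h2 : (a i : ℝ) * b j = a j * b i := by linarith
  exact_mod_cast h2

theorem IsFacet.exists_isRoot {n k : ℕ} {a : ZMod n → ℤ} {α : ℤ} (hf : IsFacet n k a α)
    (hn : 2 ≤ n) : ∃ x, IsRoot n k a α x := by
  by_contra! hcon
  have h := hf.2
  have he : {v : ZMod n → ℝ | ∃ x : Finset (ZMod n), IsRoot n k a α x ∧ v = charVec n x} = ∅ := by
    ext v
    simp [hcon]
  rw [he, AffineSubspace.span_empty, AffineSubspace.direction_bot, finrank_bot] at h
  omega

theorem IsFacet.exists_two_le_card_inter {n k : ℕ} [NeZero n] {a : ZMod n → ℤ} {α : ℤ}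
    (hf : IsFacet n k a α) (ha : ∀ i, 1 ≤ a i) (hk : 0 < k) (hkn : k < n) (i : ZMod n) :
    ∃ x, IsRoot n k a α x ∧ 2 ≤ (x ∩ Cseg n k i).card := by
  by_contra! hcon
  have hb : ∀ x, IsRoot n k a α x → ∑ j ∈ x, indicatorInt (Cseg n k i) j = 1 := by
    intro x hx
    have h1 := hcon x hx
    have h2 := (hx.1 i).card_pos
    have h3 : (x ∩ Cseg n k i).card = 1 := by omega
    simp [indicatorInt, Finset.sum_ite_mem, h3]
  obtain ⟨j, hj⟩ : ∃ j, j ∉ Cseg n k i := by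
    by_contra! hall
    have h1 : (Cseg n k i).card ≤ k := Finset.card_image_le.trans (by simp)
    rw [Finset.eq_univ_iff_forall.2 hall, Finset.card_univ, ZMod.card] at h1
    omega
  have hi : i ∈ Cseg n k i := Finset.mem_image.2 ⟨0, by simpa using hk, by simp⟩
  have := hf.proportional hb i j
  simp [indicatorInt, hi, hj] at this
  linarith [ha j]

theorem IsFacet.eq_const_of_card_eq {n k m : ℕ} [NeZero n] {a : ZMod n → ℤ} {α : ℤ}
    (hf : IsFacet n k a α) (ha : ∀ i, 1 ≤ a i) (hn : 2 ≤ n)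
    (hm : ∀ x, IsRoot n k a α x → x.card = m) :
    ∃ c : ℤ, 0 < c ∧ (∀ i, a i = c) ∧ α = c * m := by
  have hc : ∀ i, a i = a 0 := fun i => by
    have := hf.proportional (b := fun _ => 1) (β := m) (fun x hx => by simp [hm x hx]) i 0
    simpa using this
  obtain ⟨x, hx⟩ := hf.exists_isRoot hn
  refine ⟨a 0, by linarith [ha 0], hc, ?_⟩
  rw [← hx.2, Finset.sum_congr rfl fun i _ => hc i, Finset.sum_const, hm x hx, nsmul_eq_mul,
    mul_comm]

theorem exists_isCover_card_le {s k r : ℕ} (hr1 : 1 ≤ r) (hrk : r ≤ k) :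
    ∃ x, IsCover (s * k + r) k x ∧ x.card ≤ s + 1 := by
  have : NeZero (s * k + r) := ⟨by omega⟩
  refine ⟨(Finset.range (s + 1)).image fun h : ℕ => ((h * k : ℕ) : ZMod (s * k + r)), ?_,
    Finset.card_image_le.trans (by simp)⟩
  intro i
  have hi : ((i.val : ℕ) : ZMod (s * k + r)) = i := by simp
  have hlt := ZMod.val_lt i
  rcases le_or_gt i.val (s * k) with hle | hgt
  · set h := (i.val + (k - 1)) / k with hh
    have h1 : h * k ≤ i.val + (k - 1) := Nat.div_mul_le_self _ _
    have h2 : i.val + (k - 1) < (h + 1) * k := by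
      have := Nat.lt_div_mul_add (a := i.val + (k - 1)) (b := k) (by omega)
      rw [add_mul, one_mul]
      exact this
    rw [add_mul, one_mul] at h2
    have h3 : h < s + 1 := by
      refine Nat.lt_of_mul_lt_mul_right (a := k) ?_
      rw [add_mul, one_mul]
      omega
    refine ⟨((h * k : ℕ) : ZMod (s * k + r)), Finset.mem_inter.2
      ⟨Finset.mem_image.2 ⟨h, by simpa using h3, rfl⟩,
        Finset.mem_image.2 ⟨h * k - i.val, by simp; omega, ?_⟩⟩⟩
    nth_rewrite 1 [← hi]
    rw [← Nat.cast_add]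
    congr 1
    omega
  · refine ⟨0, Finset.mem_inter.2
      ⟨Finset.mem_image.2 ⟨0, by simp, by simp⟩,
        Finset.mem_image.2 ⟨s * k + r - i.val, by simp; omega, ?_⟩⟩⟩
    nth_rewrite 1 [← hi]
    rw [← Nat.cast_add, Nat.add_sub_cancel' hlt.le]
    simp

/-- A facet with positive coefficients does not have roots of both sizes `4` and `5`. -/
theorem IsFacet.not_card_four_and_five {n k : ℕ} [NeZero n] {a : ZMod n → ℤ} {α : ℤ}
    (hf : IsFacet n k a α) (ha : ∀ i, 1 ≤ a i) (hk : 0 < k) (hkn : k < n) (hn : n < 3 * k + 3)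
    {x y : Finset (ZMod n)} (hx : IsRoot n k a α x) (hy : IsRoot n k a α y)
    (hx4 : x.card = 4) (hy5 : y.card = 5) : False := by
  choose z hz hz2 using hf.exists_two_le_card_inter ha hk hkn
  set m : ℤ := ∑ l, ((z l).card : ℤ) with hm
  obtain ⟨A, B, hAB⟩ : ∃ A B : ℕ, (A : ℤ) - B = 9 * (n + 1) - 2 * m :=
    ⟨(9 * ((n : ℤ) + 1) - 2 * m).toNat, (-(9 * ((n : ℤ) + 1) - 2 * m)).toNat, by omega⟩
  obtain ⟨L, hL⟩ : ∃ L : ℕ, n + 1 + A + B = 2 * L := ⟨(n + 1 + A + B) / 2, by omega⟩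
  have hα : 0 < α := by
    rw [← hx.2]
    exact Finset.sum_pos (fun i _ => by linarith [ha i]) (Finset.card_pos.1 (by omega))
  set Z : ZMod n → ℤ := fun i =>
    ∑ l, indicatorInt (z l) i + A * indicatorInt y i + B * indicatorInt x i with hZ
  have hZ0 : ∀ i, 0 ≤ Z i := fun i => by
    have h1 : 0 ≤ ∑ l, indicatorInt (z l) i :=
      Finset.sum_nonneg fun l _ => indicatorInt_nonneg _ _
    have h2 := indicatorInt_nonneg x i
    have h3 := indicatorInt_nonneg y i
    positivity
  have hone : ∀ w, IsRoot n k a α w → ∀ i,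
      1 ≤ ∑ h ∈ Finset.range k, indicatorInt w (i + (h : ZMod n)) := fun w hw i => by
    have h1 := card_inter_Cseg_le (k := k) w i
    have h2 := (hw.1 i).card_pos
    omega
  have hN : ∀ i : ZMod n, (2 * L : ℤ) ≤ ∑ h ∈ Finset.range k, Z (i + h) := by
    intro i
    simp only [hZ, Finset.sum_add_distrib, ← Finset.mul_sum]
    rw [Finset.sum_comm]
    have h1 : (n : ℤ) + 1
        ≤ ∑ l, ∑ h ∈ Finset.range k, indicatorInt (z l) (i + (h : ZMod n)) := by
      have h2 : ∑ l : ZMod n, ((1 : ℤ) + if l = i then 1 else 0)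
          ≤ ∑ l, ∑ h ∈ Finset.range k, indicatorInt (z l) (i + (h : ZMod n)) := by
        refine Finset.sum_le_sum fun l _ => ?_
        split_ifs with hl
        · subst hl
          have h3 := card_inter_Cseg_le (k := k) (z l) l
          have h4 := hz2 l
          omega
        · simpa using hone _ (hz l) i
      simpa [Finset.sum_add_distrib, ZMod.card] using h2
    have h5 := mul_le_mul_of_nonneg_left (hone y hy i) (Int.natCast_nonneg A)
    have h6 := mul_le_mul_of_nonneg_left (hone x hx i) (Int.natCast_nonneg B)
    push_cast [← @Nat.cast_inj ℤ] at hL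
    linarith
  have hM : ∑ i, Z i = 9 * L := by
    simp only [hZ, Finset.sum_add_distrib, ← Finset.mul_sum]
    rw [Finset.sum_comm]
    simp only [sum_indicatorInt, hx4, hy5, ← hm]
    push_cast
    omega
  have hcount := isCounting_countingOf (k := k) hZ0 hN
  rw [hM] at hcount
  have hle := hcount.mul_le_weight (by omega) hn hf.1 fun i => by linarith [ha i]
  have hw : countingWeight n a (countingOf Z) = (n + A + B) * α := by
    rw [countingWeight_countingOf]
    have h1 : ∀ i, a i * Z i = ∑ l, a i * indicatorInt (z l) i
        + A * (a i * indicatorInt y i) + B * (a i * indicatorInt x i) := fun i => by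
      rw [← Finset.mul_sum]; simp only [hZ]; ring
    simp only [h1, Finset.sum_add_distrib, ← Finset.mul_sum]
    have h2 : ∑ i, a i * ∑ l, indicatorInt (z l) i = n * α := by
      simp only [Finset.mul_sum]
      rw [Finset.sum_comm]
      simp only [sum_mul_indicatorInt, (hz _).2]
      simp [ZMod.card]
    rw [h2, sum_mul_indicatorInt, sum_mul_indicatorInt, hx.2, hy.2]
    ring
  rw [hw] at hle
  have hL2 : (n : ℤ) + 1 + A + B = 2 * L := by exact_mod_cast hL
  nlinarith

theorem stmt12 (s k r : ℕ) (hk : 3 ≤ k) (hs : s = 2 ∨ s = 3) (hr1 : 1 ≤ r) (hr2 : r ≤ s - 1)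
    (a : ZMod (s * k + r) → ℤ) (α : ℤ) (hpos : ∀ i : ZMod (s * k + r), 1 ≤ a i)
    (hfacet : IsFacet (s * k + r) k a α)
    (hnonbool : ¬ IsBooleanMultiple (s * k + r) k a α) :
    ∃ c : ℤ, 0 < c ∧ (∀ i : ZMod (s * k + r), a i = c) ∧ α = c * ((s : ℤ) + 1) := by
  have : NeZero (s * k + r) := ⟨by omega⟩
  have hsk : 2 * k ≤ s * k := Nat.mul_le_mul_right _ (by omega)
  have hlow : ∀ x, IsRoot (s * k + r) k a α x → s + 1 ≤ x.card := by
    intro x hx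
    have h1 := hx.1.isCounting.le_total
    have h2 : s * k + r ≤ x.card * k := by
      zify
      push_cast at h1
      linarith
    exact Nat.lt_of_mul_lt_mul_right (a := k) (by omega)
  have hup : ∀ x, IsRoot (s * k + r) k a α x → x.card < 2 * s := fun x hx =>
    hx.card_lt hfacet.1 hpos (2 * s) (by omega) (by
      rw [mul_add, mul_add, mul_assoc]; omega)
  obtain ⟨x₀, hx₀⟩ := hfacet.exists_isRoot (by omega)
  have hsame : ∀ x, IsRoot (s * k + r) k a α x → x.card = x₀.card := by
    intro x hx
    have h1 := hlow x hx
    have h2 := hup x hx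
    have h3 := hlow x₀ hx₀
    have h4 := hup x₀ hx₀
    rcases hs with rfl | rfl
    · omega
    · by_contra hne
      rcases (by omega : x.card = 4 ∧ x₀.card = 5 ∨ x₀.card = 4 ∧ x.card = 5) with h | h
      · exact hfacet.not_card_four_and_five hpos (by omega) (by omega) (by omega) hx hx₀ h.1 h.2
      · exact hfacet.not_card_four_and_five hpos (by omega) (by omega) (by omega) hx₀ hx h.1 h.2
  obtain ⟨c, hc0, hc, hα⟩ := hfacet.eq_const_of_card_eq hpos (by omega) hsame
  refine ⟨c, hc0, hc, ?_⟩
  obtain ⟨y, hy, hycard⟩ := exists_isCover_card_le (s := s) (k := k) hr1 (by omega)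
  have h1 := hfacet.1 y hy
  rw [Finset.sum_congr rfl fun i _ => hc i, Finset.sum_const, nsmul_eq_mul, hα,
    mul_comm c] at h1
  have h2 : x₀.card ≤ y.card := by exact_mod_cast le_of_mul_le_mul_right h1 hc0
  have h3 : x₀.card = s + 1 := le_antisymm (h2.trans hycard) (hlow x₀ hx₀)
  rw [hα, h3]
  push_cast
  rfl
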